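/- arXiv:2504.06048 — 2 statements merged into one kernel-verified Lean document; each statement's English description precedes it below -/
import Mathlib

section
/- (Theorem 2.1, optimality part, made precise) Relative to a full-support prior policy π, define q*_t(s,a) = π_t(s,a)·exp(Q⁰_t(s,a) − W_t(s)). Then q* is a policy (each q*_t(s,·) is nonnegative and sums to 1), q* maximizes the KL-regularized objective L over all policies q satisfying q_t(s,a) > 0 → π_t(s,a) > 0, and the optimal value is L(q*) = Σ_s p₁(s)·W_1(s). -/
/-- Probability of a trajectory `x` (index `i : Fin T` represents time `i+1`, so times run
over `1,…,T`) under initial distribution `p₁`, transition kernel `P` and policy `q`: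
`p_q(h) = p₁(s₁) · ∏_{t=1}^T q_t(s_t,a_t) · ∏_{t=2}^T P(s_{t−1},a_{t−1},s_t)`. -/
noncomputable def pTraj {S A : Type} (T : ℕ) (p₁ : S → ℝ) (P : S → A → S → ℝ)
    (q : ℕ → S → A → ℝ) (x : Fin T → S × A) : ℝ :=
  (if h0 : 0 < T then p₁ (x ⟨0, h0⟩).1 else 1) *
    (∏ i : Fin T, q (i.1 + 1) (x i).1 (x i).2) *
    ∏ i : Fin T, if hlt : i.1 + 1 < T then P (x i).1 (x i).2 (x ⟨i.1 + 1, hlt⟩).1 else 1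

/-- Return of a trajectory: `R(h) = ∑_{t=1}^T R(s_t,a_t)`. -/
noncomputable def ret {S A : Type} (T : ℕ) (R : S → A → ℝ) (x : Fin T → S × A) : ℝ :=
  ∑ i : Fin T, R (x i).1 (x i).2

/-- Value of a policy: `J(q) = ∑_h p_q(h)·R(h)`. -/
noncomputable def Jval {S A : Type} [Fintype S] [Fintype A] (T : ℕ) (p₁ : S → ℝ) (P : S → A → S → ℝ)
    (R : S → A → ℝ) (q : ℕ → S → A → ℝ) : ℝ :=
  ∑ x : Fin T → S × A, pTraj T p₁ P q x * ret T R x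

/-- KL-regularized objective of `q` relative to the prior `π`:
`L(q) = ∑_{h : p_q(h)>0} p_q(h)·(R(h) + ∑_{t=1}^T log(π_t(s_t,a_t)/q_t(s_t,a_t)))`. -/
noncomputable def Lval {S A : Type} [Fintype S] [Fintype A] (T : ℕ) (p₁ : S → ℝ) (P : S → A → S → ℝ)
    (R : S → A → ℝ) (π q : ℕ → S → A → ℝ) : ℝ :=
  ∑ x : Fin T → S × A,
    if 0 < pTraj T p₁ P q x then
      pTraj T p₁ P q x * (ret T R x +
        ∑ i : Fin T,
          Real.log (π (i.1 + 1) (x i).1 (x i).2 / q (i.1 + 1) (x i).1 (x i).2))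
    else 0

/-- `q` is a (nonstationary) policy for times `1,…,T`. -/
def IsPolicy {S A : Type} [Fintype A] (T : ℕ) (q : ℕ → S → A → ℝ) : Prop :=
  ∀ t ∈ Finset.Icc 1 T, ∀ s : S, (∀ a : A, 0 ≤ q t s a) ∧ (∑ a : A, q t s a) = 1

/-- `π` has full support: `π_t(s,a) > 0` for all `t,s,a`. -/
def FullSupport {S A : Type} (T : ℕ) (π : ℕ → S → A → ℝ) : Prop :=
  ∀ t ∈ Finset.Icc 1 T, ∀ (s : S) (a : A), 0 < π t s a

/-- `q` is absolutely continuous w.r.t. `π`: `q_t(s,a) > 0 → π_t(s,a) > 0`. -/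
def AbsCont {S A : Type} (T : ℕ) (q π : ℕ → S → A → ℝ) : Prop :=
  ∀ t ∈ Finset.Icc 1 T, ∀ (s : S) (a : A), 0 < q t s a → 0 < π t s a

/-- KL divergence on a finite type: `KL(u‖v) = ∑_{x : u(x)>0} u(x)·log(u(x)/v(x))`. -/
noncomputable def KL {X : Type} [Fintype X] (u v : X → ℝ) : ℝ :=
  ∑ x : X, if 0 < u x then u x * Real.log (u x / v x) else 0

lemma pTraj_nonneg {S A : Type} [Fintype A] {T : ℕ} {p : S → ℝ} (hp : ∀ s, 0 ≤ p s)
    {P : S → A → S → ℝ} (hP : ∀ s a s', 0 ≤ P s a s') {q : ℕ → S → A → ℝ} (hq : IsPolicy T q)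
    (x : Fin T → S × A) : 0 ≤ pTraj T p P q x := by
  unfold pTraj
  refine mul_nonneg (mul_nonneg ?_ (Finset.prod_nonneg fun i _ => ?_))
    (Finset.prod_nonneg fun i _ => ?_)
  · split_ifs
    exacts [hp _, zero_le_one]
  · exact (hq (i.1 + 1) (Finset.mem_Icc.2 ⟨by lia, by lia⟩) _).1 _
  · split_ifs
    exacts [hP _ _ _, zero_le_one]

lemma IsPolicy.tail {S A : Type} [Fintype A] {T : ℕ} {q : ℕ → S → A → ℝ}
    (hq : IsPolicy (T + 1) q) : IsPolicy T fun t => q (t + 1) := by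
  intro t ht
  rw [Finset.mem_Icc] at ht
  exact hq (t + 1) (Finset.mem_Icc.2 ⟨by lia, by lia⟩)

lemma pTraj_cons {S A : Type} (T : ℕ) (p : S → ℝ) (P : S → A → S → ℝ) (q : ℕ → S → A → ℝ)
    (z : S × A) (y : Fin T → S × A) :
    pTraj (T + 1) p P q (Fin.cons z y : Fin (T + 1) → S × A) =
      p z.1 * q 1 z.1 z.2 * pTraj T (P z.1 z.2) P (fun t => q (t + 1)) y := by
  have hstart : (⟨0, Nat.succ_pos T⟩ : Fin (T + 1)) = 0 := rfl
  have hsucc : ∀ (k : ℕ) (h : k + 1 < T + 1),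
      (Fin.cons z y : Fin (T + 1) → S × A) ⟨k + 1, h⟩ = y ⟨k, by lia⟩ := fun _ _ => rfl
  simp only [pTraj, Fin.prod_univ_succ, Fin.cons_zero, Fin.cons_succ, Fin.val_zero, Fin.val_succ,
    Nat.succ_pos, dite_true, hstart, hsucc, zero_add, Nat.add_lt_add_iff_right]
  ring_nf

lemma sum_trajectory_succ {X : Type} [Fintype X] (T : ℕ) (f : (Fin (T + 1) → X) → ℝ) :
    ∑ x, f x = ∑ z : X, ∑ y : Fin T → X, f (Fin.cons z y : Fin (T + 1) → X) := by
  rw [← Fintype.sum_prod_type', ← (Fin.consEquiv fun _ => X).sum_comp]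
  rfl

lemma sum_pTraj {S A : Type} [Fintype S] [Fintype A] (T : ℕ) {p : S → ℝ} (hp : ∑ s, p s = 1)
    {P : S → A → S → ℝ} (hP : ∀ s a, ∑ s', P s a s' = 1) {q : ℕ → S → A → ℝ}
    (hq : IsPolicy T q) : ∑ x, pTraj T p P q x = 1 := by
  induction T generalizing p q with
  | zero => simp [pTraj]
  | succ T ih =>
    simp_rw [sum_trajectory_succ, pTraj_cons, ← Finset.mul_sum, ih (hP _ _) hq.tail, mul_one,
      Fintype.sum_prod_type, ← Finset.mul_sum, (hq 1 (Finset.mem_Icc.2 ⟨le_rfl, by lia⟩) _).2,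
      mul_one, hp]

lemma Lval_eq_sum {S A : Type} [Fintype S] [Fintype A] {T : ℕ} {p : S → ℝ} (hp : ∀ s, 0 ≤ p s)
    {P : S → A → S → ℝ} (hP : ∀ s a s', 0 ≤ P s a s') (R : S → A → ℝ) (π : ℕ → S → A → ℝ)
    {q : ℕ → S → A → ℝ} (hq : IsPolicy T q) :
    Lval T p P R π q = ∑ x : Fin T → S × A, pTraj T p P q x * (ret T R x +
      ∑ i : Fin T,
        Real.log (π (i.1 + 1) (x i).1 (x i).2 / q (i.1 + 1) (x i).1 (x i).2)) := by
  refine Finset.sum_congr rfl fun x _ => ?_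
  split_ifs with h
  · rfl
  · rw [le_antisymm (not_lt.1 h) (pTraj_nonneg hp hP hq x), zero_mul]

/-- Dynamic-programming recursion for the KL-regularized objective. -/
lemma Lval_succ {S A : Type} [Fintype S] [Fintype A] {T : ℕ} {p : S → ℝ} (hp : ∀ s, 0 ≤ p s)
    {P : S → A → S → ℝ} (hP : ∀ s a s', 0 ≤ P s a s') (hPsum : ∀ s a, ∑ s', P s a s' = 1)
    (R : S → A → ℝ) (π : ℕ → S → A → ℝ) {q : ℕ → S → A → ℝ} (hq : IsPolicy (T + 1) q) :
    Lval (T + 1) p P R π q = ∑ s, p s * ∑ a, q 1 s a *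
      (R s a + Lval T (P s a) P R (fun t => π (t + 1)) (fun t => q (t + 1)) +
        Real.log (π 1 s a / q 1 s a)) := by
  rw [Lval_eq_sum hp hP R π hq, sum_trajectory_succ, Fintype.sum_prod_type]
  refine Finset.sum_congr rfl fun s _ => ?_
  rw [Finset.mul_sum]
  refine Finset.sum_congr rfl fun a _ => ?_
  have hsum := sum_pTraj T (hPsum s a) hPsum hq.tail
  rw [Lval_eq_sum (hP s a) hP R _ hq.tail, ← mul_assoc, add_right_comm,
    ← mul_one (R s a + Real.log _), ← hsum, Finset.mul_sum, ← Finset.sum_add_distrib,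
    Finset.mul_sum]
  refine Finset.sum_congr rfl fun y _ => ?_
  simp only [pTraj_cons, ret, Fin.sum_univ_succ, Fin.cons_zero, Fin.cons_succ, Fin.val_zero,
    Fin.val_succ, zero_add]
  ring

lemma sum_mul_exp_pos {A : Type} [Fintype A] [Nonempty A] {w : A → ℝ} (hw : ∀ a, 0 < w a)
    (Q : A → ℝ) : 0 < ∑ a, w a * Real.exp (Q a) :=
  Finset.sum_pos (fun a _ => mul_pos (hw a) (Real.exp_pos _)) Finset.univ_nonempty

lemma sum_gibbs {A : Type} [Fintype A] [Nonempty A] {w : A → ℝ} (hw : ∀ a, 0 < w a)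
    (Q : A → ℝ) :
    ∑ a, w a * Real.exp (Q a - Real.log (∑ b, w b * Real.exp (Q b))) = 1 := by
  have hZ := sum_mul_exp_pos hw Q
  simp_rw [Real.exp_sub, Real.exp_log hZ, ← mul_div_assoc, ← Finset.sum_div]
  exact div_self hZ.ne'

/-- The Gibbs variational inequality on a finite type. -/
lemma gibbs_variational_le {A : Type} [Fintype A] [Nonempty A] {w : A → ℝ} (hw : ∀ a, 0 < w a)
    (Q : A → ℝ) {u : A → ℝ} (hu : ∀ a, 0 ≤ u a) (husum : ∑ a, u a = 1) :
    ∑ a, u a * (Q a + Real.log (w a / u a)) ≤ Real.log (∑ a, w a * Real.exp (Q a)) := by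
  set V := Real.log (∑ a, w a * Real.exp (Q a)) with hV
  have hterm : ∀ a, u a * (Q a + Real.log (w a / u a)) ≤
      u a * V + (w a * Real.exp (Q a - V) - u a) := by
    intro a
    rcases (hu a).eq_or_lt with h | h
    · simpa [← h] using (mul_pos (hw a) (Real.exp_pos _)).le
    · have hlog := Real.log_le_sub_one_of_pos
        (mul_pos (div_pos (hw a) h) (Real.exp_pos (Q a - V)))
      rw [Real.log_mul (div_pos (hw a) h).ne' (Real.exp_pos _).ne', Real.log_exp] at hlog
      have := mul_le_mul_of_nonneg_left hlog h.le
      have he : u a * (w a / u a * Real.exp (Q a - V) - 1) =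
          w a * Real.exp (Q a - V) - u a := by
        field_simp
      linarith
  calc _ ≤ ∑ a, (u a * V + (w a * Real.exp (Q a - V) - u a)) :=
        Finset.sum_le_sum fun a _ => hterm a
    _ = V := by
        rw [Finset.sum_add_distrib, Finset.sum_sub_distrib, ← Finset.sum_mul, husum,
          sum_gibbs hw Q]
        ring

lemma gibbs_variational_eq {A : Type} [Fintype A] [Nonempty A] {w : A → ℝ} (hw : ∀ a, 0 < w a)
    (Q : A → ℝ) {u : A → ℝ}
    (hu : ∀ a, u a = w a * Real.exp (Q a - Real.log (∑ b, w b * Real.exp (Q b)))) :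
    ∑ a, u a * (Q a + Real.log (w a / u a)) = Real.log (∑ a, w a * Real.exp (Q a)) := by
  have hterm : ∀ a, Q a + Real.log (w a / u a) = Real.log (∑ a, w a * Real.exp (Q a)) := by
    intro a
    rw [hu a, div_mul_cancel_left₀ (hw a).ne', Real.log_inv, Real.log_exp]
    ring
  simp_rw [hterm, ← Finset.sum_mul, hu, sum_gibbs hw Q, one_mul]

/-- `W` and `Q` solve the soft Bellman equations for the prior `π` over horizon `T`. -/
structure IsSoftValue {S A : Type} [Fintype S] [Fintype A] (T : ℕ) (P : S → A → S → ℝ)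
    (R : S → A → ℝ) (π : ℕ → S → A → ℝ) (W : ℕ → S → ℝ) (Q : ℕ → S → A → ℝ) : Prop where
  terminal : ∀ s, W (T + 1) s = 0
  action : ∀ t ∈ Finset.Icc 1 T, ∀ s a, Q t s a = R s a + ∑ s', P s a s' * W (t + 1) s'
  state : ∀ t ∈ Finset.Icc 1 T, ∀ s, W t s = Real.log (∑ a, π t s a * Real.exp (Q t s a))

lemma succ_mem_Icc {T t : ℕ} (ht : t ∈ Finset.Icc 1 T) : t + 1 ∈ Finset.Icc 1 (T + 1) := by
  rw [Finset.mem_Icc] at ht ⊢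
  lia

lemma one_mem_Icc_succ (T : ℕ) : 1 ∈ Finset.Icc 1 (T + 1) :=
  Finset.mem_Icc.2 ⟨le_rfl, by lia⟩

lemma IsSoftValue.tail {S A : Type} [Fintype S] [Fintype A] {T : ℕ} {P : S → A → S → ℝ}
    {R : S → A → ℝ} {π : ℕ → S → A → ℝ} {W : ℕ → S → ℝ} {Q : ℕ → S → A → ℝ}
    (h : IsSoftValue (T + 1) P R π W Q) :
    IsSoftValue T P R (fun t => π (t + 1)) (fun t => W (t + 1)) (fun t => Q (t + 1)) :=
  ⟨h.terminal, fun t ht => h.action (t + 1) (succ_mem_Icc ht),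
    fun t ht => h.state (t + 1) (succ_mem_Icc ht)⟩

section SoftValue

variable {S A : Type} [Fintype S] [Fintype A] [Nonempty A] {T : ℕ} {P : S → A → S → ℝ}
  {R : S → A → ℝ} {π : ℕ → S → A → ℝ} {W : ℕ → S → ℝ} {Q : ℕ → S → A → ℝ}
  {p : S → ℝ} {q : ℕ → S → A → ℝ}

lemma IsSoftValue.Lval_le (h : IsSoftValue T P R π W Q) (hπ : FullSupport T π)
    (hP : ∀ s a s', 0 ≤ P s a s') (hPsum : ∀ s a, ∑ s', P s a s' = 1) (hp : ∀ s, 0 ≤ p s)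
    (hq : IsPolicy T q) : Lval T p P R π q ≤ ∑ s, p s * W 1 s := by
  induction T generalizing p q π W Q with
  | zero =>
    have hW : ∀ s, W 1 s = 0 := h.terminal
    simp [Lval, ret, hW]
  | succ T ih =>
    have h1 := one_mem_Icc_succ T
    rw [Lval_succ hp hP hPsum R π hq]
    refine Finset.sum_le_sum fun s _ => mul_le_mul_of_nonneg_left ?_ (hp s)
    rw [h.state 1 h1 s]
    refine le_trans (Finset.sum_le_sum fun a _ => mul_le_mul_of_nonneg_left ?_ ((hq 1 h1 s).1 a))
      (gibbs_variational_le (hπ 1 h1 s) (Q 1 s) (hq 1 h1 s).1 (hq 1 h1 s).2)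
    rw [h.action 1 h1 s a]
    gcongr
    exact ih h.tail (fun t ht => hπ (t + 1) (succ_mem_Icc ht)) (hP s a) hq.tail

lemma IsSoftValue.isPolicy_gibbs (h : IsSoftValue T P R π W Q) (hπ : FullSupport T π)
    (hq : ∀ t ∈ Finset.Icc 1 T, ∀ s a, q t s a = π t s a * Real.exp (Q t s a - W t s)) :
    IsPolicy T q := by
  refine fun t ht s => ⟨fun a => ?_, ?_⟩
  · rw [hq t ht]
    exact (mul_pos (hπ t ht s a) (Real.exp_pos _)).le
  · simp_rw [hq t ht, h.state t ht]
    exact sum_gibbs (hπ t ht s) (Q t s)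

lemma IsSoftValue.Lval_gibbs (h : IsSoftValue T P R π W Q) (hπ : FullSupport T π)
    (hP : ∀ s a s', 0 ≤ P s a s') (hPsum : ∀ s a, ∑ s', P s a s' = 1) (hp : ∀ s, 0 ≤ p s)
    (hq : ∀ t ∈ Finset.Icc 1 T, ∀ s a, q t s a = π t s a * Real.exp (Q t s a - W t s)) :
    Lval T p P R π q = ∑ s, p s * W 1 s := by
  induction T generalizing p q π W Q with
  | zero =>
    have hW : ∀ s, W 1 s = 0 := h.terminal
    simp [Lval, ret, hW]
  | succ T ih =>
    have h1 := one_mem_Icc_succ T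
    rw [Lval_succ hp hP hPsum R π (h.isPolicy_gibbs hπ hq)]
    refine Finset.sum_congr rfl fun s _ => ?_
    have hg := gibbs_variational_eq (hπ 1 h1 s) (Q 1 s) (u := q 1 s)
      fun a => by rw [hq 1 h1, h.state 1 h1]
    rw [h.state 1 h1 s, ← hg]
    congr 1
    refine Finset.sum_congr rfl fun a _ => ?_
    rw [h.action 1 h1 s a, ih h.tail (fun t ht => hπ (t + 1) (succ_mem_Icc ht)) (hP s a)
      fun t ht => hq (t + 1) (succ_mem_Icc ht)]

end SoftValue

/-- Theorem 2.1, optimality part: `q*_t(s,a) = π_t(s,a)·exp(Q⁰_t(s,a) − W_t(s))`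
is a policy, maximizes the KL-regularized objective `L` over all policies absolutely continuous
w.r.t. `π`, and `L(q*) = ∑_s p₁(s)·W_1(s)`. -/
theorem stmt_1 {S A : Type} [Fintype S] [Fintype A] [Nonempty S] [Nonempty A]
    (T : ℕ) (hT : 1 ≤ T)
    (p₁ : S → ℝ) (hp₁ : ∀ s, 0 ≤ p₁ s) (hp₁sum : (∑ s : S, p₁ s) = 1)
    (P : S → A → S → ℝ) (hP : ∀ s a s', 0 ≤ P s a s')
    (hPsum : ∀ s a, (∑ s' : S, P s a s') = 1)
    (R : S → A → ℝ)
    (π : ℕ → S → A → ℝ) (hπ : IsPolicy T π) (hπpos : FullSupport T π)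
    (W : ℕ → S → ℝ) (Q0 : ℕ → S → A → ℝ)
    (hWT : ∀ s, W (T + 1) s = 0)
    (hQ0 : ∀ t ∈ Finset.Icc 1 T, ∀ (s : S) (a : A),
      Q0 t s a = R s a + ∑ s' : S, P s a s' * W (t + 1) s')
    (hW : ∀ t ∈ Finset.Icc 1 T, ∀ s : S,
      W t s = Real.log (∑ a : A, π t s a * Real.exp (Q0 t s a)))
    (qstar : ℕ → S → A → ℝ)
    (hqstar : ∀ t ∈ Finset.Icc 1 T, ∀ (s : S) (a : A),
      qstar t s a = π t s a * Real.exp (Q0 t s a - W t s)) :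
    IsPolicy T qstar ∧
      (∀ q : ℕ → S → A → ℝ, IsPolicy T q → AbsCont T q π →
        Lval T p₁ P R π q ≤ Lval T p₁ P R π qstar) ∧
      Lval T p₁ P R π qstar = ∑ s : S, p₁ s * W 1 s := by
  have h : IsSoftValue T P R π W Q0 := ⟨hWT, hQ0, hW⟩
  have hL := h.Lval_gibbs hπpos hP hPsum hp₁ hqstar
  exact ⟨h.isPolicy_gibbs hπpos hqstar,
    fun q hq _ => hL ▸ h.Lval_le hπpos hP hPsum hp₁ hq, hL⟩
end

section
/- (Lagrangian solution solves the trust-region problem of Eq. 8) Let X be a finite nonempty type, p : X → ℝ with p(x) > 0 for all x and Σ_x p(x) = 1, f : X → ℝ, and β ≥ 0. Set ε = KL(q_β ‖ p). Then for every q : X → ℝ with q ≥ 0, Σ_x q(x) = 1, and KL(q‖p) ≤ ε, one has Σ_x q(x)·f(x) ≤ Σ_x q_β(x)·f(x); i.e. q_β maximizes the expected value of f over all distributions satisfying the trust-region constraint KL(q‖p) ≤ ε. -/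
/-- Exponentially tilted distribution `q_β(x) = p(x)·exp(β·f(x)) / ∑_y p(y)·exp(β·f(y))`. -/
noncomputable def qtilt {X : Type} [Fintype X] (p f : X → ℝ) (β : ℝ) (x : X) : ℝ :=
  p x * Real.exp (β * f x) / ∑ y : X, p y * Real.exp (β * f y)

open InformationTheory in
theorem KL_eq_sum_klFun {X : Type} [Fintype X] {u v : X → ℝ} (hu : ∀ x, 0 ≤ u x)
    (hv : ∀ x, 0 < v x) (huv : ∑ x, u x = ∑ x, v x) :
    KL u v = ∑ x, v x * klFun (u x / v x) := by
  have hterm (x : X) : (if 0 < u x then u x * Real.log (u x / v x) else 0) =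
      v x * klFun (u x / v x) + (u x - v x) := by
    have hvx := (hv x).ne'
    split_ifs with h
    · rw [klFun]
      field_simp
      ring
    · have hux : u x = 0 := le_antisymm (not_lt.mp h) (hu x)
      simp [hux, klFun]
  simp [KL, hterm, Finset.sum_add_distrib, huv]

open InformationTheory in
theorem KL_nonneg {X : Type} [Fintype X] {u v : X → ℝ} (hu : ∀ x, 0 ≤ u x)
    (hv : ∀ x, 0 < v x) (huv : ∑ x, u x = ∑ x, v x) : 0 ≤ KL u v := by
  rw [KL_eq_sum_klFun hu hv huv]
  exact Finset.sum_nonneg fun x _ =>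
    mul_nonneg (hv x).le (klFun_nonneg (div_nonneg (hu x) (hv x).le))

open InformationTheory in
theorem KL_eq_zero_iff {X : Type} [Fintype X] {u v : X → ℝ} (hu : ∀ x, 0 ≤ u x)
    (hv : ∀ x, 0 < v x) (huv : ∑ x, u x = ∑ x, v x) : KL u v = 0 ↔ u = v := by
  have hdiv (x : X) : 0 ≤ u x / v x := div_nonneg (hu x) (hv x).le
  rw [KL_eq_sum_klFun hu hv huv, Finset.sum_eq_zero_iff_of_nonneg
    fun x _ => mul_nonneg (hv x).le (klFun_nonneg (hdiv x)), funext_iff]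
  refine forall_congr' fun x => ?_
  simp [(hv x).ne', klFun_eq_zero_iff (hdiv x), div_eq_one_iff_eq (hv x).ne']

theorem sum_mul_exp_pos_s14 {X : Type} [Fintype X] [Nonempty X] {p : X → ℝ} (hp : ∀ x, 0 < p x)
    (f : X → ℝ) (β : ℝ) : 0 < ∑ y, p y * Real.exp (β * f y) :=
  Finset.sum_pos (fun y _ => mul_pos (hp y) (Real.exp_pos _)) Finset.univ_nonempty

theorem qtilt_pos {X : Type} [Fintype X] [Nonempty X] {p : X → ℝ} (hp : ∀ x, 0 < p x)
    (f : X → ℝ) (β : ℝ) (x : X) : 0 < qtilt p f β x :=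
  div_pos (mul_pos (hp x) (Real.exp_pos _)) (sum_mul_exp_pos_s14 hp f β)

theorem sum_qtilt {X : Type} [Fintype X] [Nonempty X] {p : X → ℝ} (hp : ∀ x, 0 < p x)
    (f : X → ℝ) (β : ℝ) : ∑ x, qtilt p f β x = 1 := by
  simp only [qtilt]
  rw [← Finset.sum_div, div_self (sum_mul_exp_pos_s14 hp f β).ne']

theorem KL_eq_KL_qtilt_add {X : Type} [Fintype X] [Nonempty X] {p : X → ℝ}
    (hp : ∀ x, 0 < p x) (f : X → ℝ) (β : ℝ) {q : X → ℝ} (hq : ∀ x, 0 ≤ q x)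
    (hqsum : ∑ x, q x = 1) :
    KL q p = KL q (qtilt p f β) + β * ∑ x, q x * f x
      - Real.log (∑ y, p y * Real.exp (β * f y)) := by
  have hZ := sum_mul_exp_pos_s14 hp f β
  have hterm (x : X) : (if 0 < q x then q x * Real.log (q x / p x) else 0) =
      (if 0 < q x then q x * Real.log (q x / qtilt p f β x) else 0) + β * (q x * f x)
        - q x * Real.log (∑ y, p y * Real.exp (β * f y)) := by
    split_ifs with h
    · rw [Real.log_div h.ne' (hp x).ne', Real.log_div h.ne' (qtilt_pos hp f β x).ne', qtilt,
        Real.log_div (mul_pos (hp x) (Real.exp_pos _)).ne' hZ.ne',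
        Real.log_mul (hp x).ne' (Real.exp_pos _).ne', Real.log_exp]
      ring
    · have hqx : q x = 0 := le_antisymm (not_lt.mp h) (hq x)
      simp [hqx]
  simp only [KL, hterm]
  rw [Finset.sum_sub_distrib, Finset.sum_add_distrib, ← Finset.mul_sum, ← Finset.sum_mul,
    hqsum, one_mul]

/-- the Lagrangian solution solves the trust-region problem: with
`ε = KL(q_β ‖ p)`, the tilted distribution `q_β` maximizes `∑ q·f` over all distributions `q`
with `KL(q‖p) ≤ ε`. -/
theorem stmt_14 {X : Type} [Fintype X] [Nonempty X]
    (p : X → ℝ) (hp : ∀ x, 0 < p x) (hpsum : (∑ x : X, p x) = 1)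
    (f : X → ℝ) (β : ℝ) (hβ : 0 ≤ β) :
    ∀ q : X → ℝ, (∀ x, 0 ≤ q x) → (∑ x : X, q x) = 1 →
      KL q p ≤ KL (qtilt p f β) p →
      (∑ x : X, q x * f x) ≤ ∑ x : X, qtilt p f β x * f x := by
  intro q hq hqsum hKL
  have hpos := qtilt_pos hp f β
  have hsum : ∑ x, q x = ∑ x, qtilt p f β x := hqsum.trans (sum_qtilt hp f β).symm
  rw [KL_eq_KL_qtilt_add hp f β hq hqsum,
    KL_eq_KL_qtilt_add hp f β (fun x => (hpos x).le) (sum_qtilt hp f β),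
    (KL_eq_zero_iff (fun x => (hpos x).le) hpos rfl).2 rfl] at hKL
  by_contra! hlt
  have hβle := mul_le_mul_of_nonneg_left hlt.le hβ
  have hzero : KL q (qtilt p f β) = 0 :=
    le_antisymm (by linarith) (KL_nonneg hq hpos hsum)
  rw [(KL_eq_zero_iff hq hpos hsum).1 hzero] at hlt
  exact lt_irrefl _ hlt
end
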